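/- For a Borel probability measure Q on [0,1]^p define its kernel mean embedding as the function Φ0(Q)(z) = ∫ k0(x,z) Q(dx), z ∈ [0,1]^p. Call ν determining if for all Borel probability measures Q1, Q2 on [0,1]^p, Q1(A) = Q2(A) for ν-almost every A ∈ 𝒜 implies Q1 = Q2. Then the map Q ↦ Φ0(Q) is injective on the set of Borel probability measures on [0,1]^p if and only if ν is determining. If moreover ∫_𝒜 α_P²(A) ν(dA) < ∞, these properties are also equivalent to the injectivity of the map Q ↦ Φ(Q), where Φ(Q)(z) = ∫ k(x,z) Q(dx). -/

import Mathlib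

open MeasureTheory
open scoped ENNReal RealInnerProductSpace

noncomputable section

/-- Points of the unit cube `[0,1]^p`. -/
abbrev Pt (p : ℕ) : Type := Fin p → Set.Icc (0 : ℝ) 1

/-- Hyperrectangles `∏_j [a_j, b_j⟩` of `[0,1]^p`, encoded by the pair of endpoints
`(a, b)` with `0 ≤ a_j < b_j ≤ 1`, viewed as a subtype of `(Fin p → ℝ) × (Fin p → ℝ)`
with the inherited sup metric (which is exactly the metric `ρ`) and its Borel σ-algebra. -/
abbrev HRect (p : ℕ) : Type :=
  {ab : (Fin p → ℝ) × (Fin p → ℝ) // ∀ j, 0 ≤ ab.1 j ∧ ab.1 j < ab.2 j ∧ ab.2 j ≤ 1}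

/-- Membership `z ∈ [a, b⟩`: `a_j ≤ z_j` and (`z_j < b_j`, or `b_j = 1` in which case
`z_j ≤ b_j` holds automatically). -/
def memRect {p : ℕ} (z : Pt p) (A : HRect p) : Prop :=
  ∀ j, A.1.1 j ≤ (z j : ℝ) ∧ ((z j : ℝ) < A.1.2 j ∨ A.1.2 j = 1)

/-- The indicator `1_A(z)`. -/
def ind {p : ℕ} (z : Pt p) (A : HRect p) : ℝ :=
  haveI := Classical.propDecidable (memRect z A)
  if memRect z A then 1 else 0

/-- The kernel `k0(z,z') = ∫ 1_A(z) 1_A(z') ν(dA)`. -/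
def k0 {p : ℕ} (ν : Measure (HRect p)) (z z' : Pt p) : ℝ :=
  ∫ A, ind z A * ind z' A ∂ν

/-- `P(A)`: the measure of the hyperrectangle `A` under the first marginal of `P`. -/
def PA {p : ℕ} (P : Measure (Pt p × ℝ)) (A : HRect p) : ℝ :=
  (P.fst {z | memRect z A}).toReal

/-- `α_P²(A) = 1/P(A)` if `P(A) > 0`, and `1` otherwise. -/
def alphaSq {p : ℕ} (P : Measure (Pt p × ℝ)) (A : HRect p) : ℝ :=
  haveI := Classical.propDecidable (0 < PA P A)
  if 0 < PA P A then 1 / PA P A else 1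

/-- The kernel `k(z,z') = ∫ α_P²(A) 1_A(z) 1_A(z') ν(dA) ∈ [0,∞]`. -/
def kk {p : ℕ} (P : Measure (Pt p × ℝ)) (ν : Measure (HRect p)) (z z' : Pt p) : ℝ≥0∞ :=
  ∫⁻ A, ENNReal.ofReal (alphaSq P A * ind z A * ind z' A) ∂ν


lemma measurableSet_memRect (p : ℕ) :
    MeasurableSet {x : Pt p × HRect p | memRect x.1 x.2} := by
  simp only [memRect, Set.ofPred_forall, Set.ofPred_and, Set.ofPred_or]
  refine MeasurableSet.iInter fun j => ?_
  have hz : Measurable fun x : Pt p × HRect p => ((x.1 j : Set.Icc (0 : ℝ) 1) : ℝ) := by fun_prop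
  have ha : Measurable fun x : Pt p × HRect p => x.2.1.1 j := by fun_prop
  have hb : Measurable fun x : Pt p × HRect p => x.2.1.2 j := by fun_prop
  exact (measurableSet_le ha hz).inter
    ((measurableSet_lt hz hb).union (measurableSet_eq_fun hb measurable_const))

lemma ind_eq_indicator {p : ℕ} (z : Pt p) (A : HRect p) :
    ind z A = {z : Pt p | memRect z A}.indicator (fun _ => (1 : ℝ)) z := by
  classical
  simp [ind, Set.indicator_apply]

lemma measurable_ind_uncurry (p : ℕ) : Measurable fun x : Pt p × HRect p => ind x.1 x.2 := by
  classical
  unfold ind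
  convert Measurable.ite (measurableSet_memRect p)
    (measurable_const (a := (1 : ℝ))) (measurable_const (a := (0 : ℝ)))

lemma measurable_ind {p : ℕ} (z : Pt p) : Measurable (ind z) :=
  (measurable_ind_uncurry p).comp measurable_prodMk_left

lemma ind_nonneg {p : ℕ} (z : Pt p) (A : HRect p) : 0 ≤ ind z A := by
  unfold ind; split_ifs <;> norm_num

lemma ind_le_one {p : ℕ} (z : Pt p) (A : HRect p) : ind z A ≤ 1 := by
  unfold ind; split_ifs <;> norm_num

lemma measurableSet_rect {p : ℕ} (A : HRect p) : MeasurableSet {z : Pt p | memRect z A} :=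
  (measurableSet_memRect p).preimage measurable_prodMk_right

lemma integral_ind {p : ℕ} (Q : Measure (Pt p)) (A : HRect p) :
    ∫ x, ind x A ∂Q = Q.real {z | memRect z A} := by
  simp_rw [ind_eq_indicator]
  exact integral_indicator_one (measurableSet_rect A)

lemma measurable_real_rect {p : ℕ} (Q : Measure (Pt p)) [IsFiniteMeasure Q] :
    Measurable fun A : HRect p => Q.real {z | memRect z A} :=
  (measurable_measure_prodMk_right (measurableSet_memRect p)).ennreal_toReal

lemma integrable_mul_ind {p : ℕ} {ν : Measure (HRect p)} {u : HRect p → ℝ}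
    (hu : Integrable u ν) (z : Pt p) : Integrable (fun A => u A * ind z A) ν := by
  refine hu.mul_bdd (c := 1) (measurable_ind z).aestronglyMeasurable (.of_forall fun A => ?_)
  rw [Real.norm_of_nonneg (ind_nonneg z A)]
  exact ind_le_one z A

lemma integrable_mul_real_rect {p : ℕ} {ν : Measure (HRect p)} {u : HRect p → ℝ}
    (hu : Integrable u ν) (Q : Measure (Pt p)) [IsProbabilityMeasure Q] :
    Integrable (fun A => u A * Q.real {z | memRect z A}) ν := by
  refine hu.mul_bdd (c := 1) (measurable_real_rect Q).aestronglyMeasurable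
    (.of_forall fun A => ?_)
  rw [Real.norm_of_nonneg measureReal_nonneg]
  exact measureReal_le_one

/-- Fubini: averaging `∫ u(A) 1_A(x) ν(dA)` over `x ∼ Q` gives `∫ u(A) Q(A) ν(dA)`. -/
lemma integral_integral_mul_ind {p : ℕ} {ν : Measure (HRect p)} [IsFiniteMeasure ν]
    {u : HRect p → ℝ} (hu : Integrable u ν) (Q : Measure (Pt p)) [IsProbabilityMeasure Q] :
    ∫ x, ∫ A, u A * ind x A ∂ν ∂Q = ∫ A, u A * Q.real {z | memRect z A} ∂ν := by
  rw [integral_integral_swap]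
  · simp_rw [integral_const_mul, integral_ind]
  · refine (hu.comp_snd Q).mul_bdd (c := 1) (measurable_ind_uncurry p).aestronglyMeasurable
      (.of_forall fun x => ?_)
    rw [Real.norm_of_nonneg (ind_nonneg x.1 x.2)]
    exact ind_le_one x.1 x.2

/-- The mean embedding of the kernel `∫ w(A) 1_A(x) 1_A(z) ν(dA)` with positive integrable
weight `w` identifies exactly the measures that agree on `ν`-almost every hyperrectangle. -/
lemma weighted_embedding_eq_iff {p : ℕ} {ν : Measure (HRect p)} [IsFiniteMeasure ν]
    {w : HRect p → ℝ} (hw : Integrable w ν) (hpos : ∀ A, 0 < w A)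
    (Q₁ Q₂ : Measure (Pt p)) [IsProbabilityMeasure Q₁] [IsProbabilityMeasure Q₂] :
    (∀ z, ∫ x, ∫ A, w A * ind x A * ind z A ∂ν ∂Q₁ = ∫ x, ∫ A, w A * ind x A * ind z A ∂ν ∂Q₂)
      ↔ ∀ᵐ A ∂ν, Q₁ {z | memRect z A} = Q₂ {z | memRect z A} := by
  have embed (Q : Measure (Pt p)) [IsProbabilityMeasure Q] (z : Pt p) :
      ∫ x, ∫ A, w A * ind x A * ind z A ∂ν ∂Q
        = ∫ A, w A * Q.real {z | memRect z A} * ind z A ∂ν := by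
    simp_rw [mul_right_comm (w _)]
    exact integral_integral_mul_ind (integrable_mul_ind hw z) Q
  simp_rw [embed]
  constructor
  · intro h
    set u : HRect p → ℝ :=
      fun A => w A * Q₁.real {z | memRect z A} - w A * Q₂.real {z | memRect z A} with hu_def
    have h₁ := integrable_mul_real_rect hw Q₁
    have h₂ := integrable_mul_real_rect hw Q₂
    have hu : Integrable u ν := h₁.sub h₂
    have hu_ind (z : Pt p) : ∫ A, u A * ind z A ∂ν = 0 := by
      simp_rw [hu_def, sub_mul]
      rw [integral_sub (integrable_mul_ind h₁ z) (integrable_mul_ind h₂ z), h z, sub_self]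
    have hu_rect (Q : Measure (Pt p)) [IsProbabilityMeasure Q] :
        ∫ A, u A * Q.real {z | memRect z A} ∂ν = 0 := by
      rw [← integral_integral_mul_ind hu Q]
      simp [hu_ind]
    have hsq (A : HRect p) :
        u A * Q₁.real {z | memRect z A} - u A * Q₂.real {z | memRect z A}
          = w A * (Q₁.real {z | memRect z A} - Q₂.real {z | memRect z A}) ^ 2 := by
      simp only [hu_def]; ring
    have hint := (integrable_mul_real_rect hu Q₁).sub (integrable_mul_real_rect hu Q₂)
    have hzero := integral_sub (integrable_mul_real_rect hu Q₁) (integrable_mul_real_rect hu Q₂)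
    rw [hu_rect Q₁, hu_rect Q₂, sub_self,
      integral_eq_zero_iff_of_nonneg
        (fun A => (mul_nonneg (hpos A).le (sq_nonneg _)).trans_eq (hsq A).symm) hint] at hzero
    filter_upwards [hzero] with A hA
    rw [hsq A] at hA
    have hdiff : Q₁.real {z | memRect z A} - Q₂.real {z | memRect z A} = 0 := by
      simpa [(hpos A).ne'] using hA
    exact (measureReal_eq_measureReal_iff).1 (sub_eq_zero.1 hdiff)
  · intro h z
    refine integral_congr_ae ?_
    filter_upwards [h] with A hA
    simp only [measureReal_def, hA]

lemma alphaSq_pos {p : ℕ} (P : Measure (Pt p × ℝ)) (A : HRect p) : 0 < alphaSq P A := by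
  unfold alphaSq
  split_ifs with h
  · exact one_div_pos.2 h
  · exact one_pos

lemma measurable_alphaSq {p : ℕ} (P : Measure (Pt p × ℝ)) [IsFiniteMeasure P] :
    Measurable (alphaSq P) := by
  have hPA : Measurable (PA P) := measurable_real_rect P.fst
  unfold alphaSq
  convert Measurable.ite (measurableSet_lt measurable_const hPA) (hPA.const_div 1)
    (measurable_const (a := (1 : ℝ)))

lemma integrable_alphaSq {p : ℕ} {ν : Measure (HRect p)} {P : Measure (Pt p × ℝ)}
    [IsFiniteMeasure P] (h : ∫⁻ A, ENNReal.ofReal (alphaSq P A) ∂ν < ⊤) :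
    Integrable (alphaSq P) ν :=
  ⟨(measurable_alphaSq P).aestronglyMeasurable,
    (hasFiniteIntegral_iff_ofReal (.of_forall fun A => (alphaSq_pos P A).le)).2 h⟩

lemma toReal_kk {p : ℕ} (P : Measure (Pt p × ℝ)) [IsFiniteMeasure P] (ν : Measure (HRect p))
    (x z : Pt p) : (kk P ν x z).toReal = ∫ A, alphaSq P A * ind x A * ind z A ∂ν :=
  (integral_eq_lintegral_of_nonneg_ae
    (.of_forall fun A =>
      mul_nonneg (mul_nonneg (alphaSq_pos P A).le (ind_nonneg x A)) (ind_nonneg z A))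
    (((measurable_alphaSq P).mul (measurable_ind x)).mul
      (measurable_ind z)).aestronglyMeasurable).symm

/-- the kernel mean embedding `Q ↦ Φ0(Q) = ∫ k0(x,·) Q(dx)` is
injective on Borel probability measures iff `ν` is determining (i.e. `Q1(A) = Q2(A)` for
ν-a.e. `A` implies `Q1 = Q2`); and if `∫ α_P²(A) ν(dA) < ∞`, this is also equivalent to
the injectivity of `Q ↦ Φ(Q) = ∫ k(x,·) Q(dx)`. -/
theorem stmt11 {p : ℕ} (ν : Measure (HRect p)) [IsFiniteMeasure ν]
    (hnorm : ∀ z : Pt p, ∫ A, ind z A ∂ν = 1)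
    (P : Measure (Pt p × ℝ)) [IsProbabilityMeasure P] :
    ((∀ Q1 Q2 : Measure (Pt p), IsProbabilityMeasure Q1 → IsProbabilityMeasure Q2 →
        (∀ z : Pt p, (∫ x, k0 ν x z ∂Q1) = ∫ x, k0 ν x z ∂Q2) → Q1 = Q2)
      ↔ (∀ Q1 Q2 : Measure (Pt p), IsProbabilityMeasure Q1 → IsProbabilityMeasure Q2 →
          (∀ᵐ A ∂ν, Q1 {z | memRect z A} = Q2 {z | memRect z A}) → Q1 = Q2)) ∧
    ((∫⁻ A, ENNReal.ofReal (alphaSq P A) ∂ν) < ⊤ →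
      ((∀ Q1 Q2 : Measure (Pt p), IsProbabilityMeasure Q1 → IsProbabilityMeasure Q2 →
          (∀ z : Pt p,
            (∫ x, (kk P ν x z).toReal ∂Q1) = ∫ x, (kk P ν x z).toReal ∂Q2) → Q1 = Q2)
        ↔ (∀ Q1 Q2 : Measure (Pt p), IsProbabilityMeasure Q1 → IsProbabilityMeasure Q2 →
            (∀ᵐ A ∂ν, Q1 {z | memRect z A} = Q2 {z | memRect z A}) → Q1 = Q2))) := by
  constructor
  · refine forall₄_congr fun Q₁ Q₂ _ _ => imp_congr ?_ Iff.rfl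
    simpa [k0] using weighted_embedding_eq_iff (ν := ν) (integrable_const (1 : ℝ))
      (fun _ => one_pos) Q₁ Q₂
  · intro h
    refine forall₄_congr fun Q₁ Q₂ _ _ => imp_congr ?_ Iff.rfl
    simp_rw [toReal_kk]
    exact weighted_embedding_eq_iff (integrable_alphaSq h) (alphaSq_pos P) Q₁ Q₂

end
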